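/- Let C_{11}^2, C_{12}^2 ∈ ℝ be arbitrary and let C_{22}^2 ∈ ℝ with C_{22}^2 ≠ 0. Consider the Type B connection on the half-plane {x¹ > 0} with Christoffel symbols Γ_{11}^1 = −1/x¹, Γ_{11}^2 = C_{11}^2/x¹, Γ_{12}^2 = Γ_{21}^2 = C_{12}^2/x¹, Γ_{22}^2 = C_{22}^2/x¹, and Γ_{12}^1 = Γ_{21}^1 = Γ_{22}^1 = 0. Then the set of smooth f on {x¹ > 0} with vanishing affine Hessian (i.e., (Hf)₁₁ = (Hf)₁₂ = (Hf)₂₂ = 0, the affine quasi-Einstein equation with μ = 0) is exactly the real span of the two functions 1 and log(x¹). -/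

import Mathlib

/-- Partial derivative in the first coordinate direction. -/
noncomputable def pd1 (f : ℝ × ℝ → ℝ) : ℝ × ℝ → ℝ := fun p => fderiv ℝ f p (1, 0)

/-- Partial derivative in the second coordinate direction. -/
noncomputable def pd2 (f : ℝ × ℝ → ℝ) : ℝ × ℝ → ℝ := fun p => fderiv ℝ f p (0, 1)

theorem aux_open : IsOpen {p : ℝ × ℝ | 0 < p.1} := isOpen_lt continuous_const continuous_fst

theorem aux_congr {F G : ℝ × ℝ → ℝ} (h : ∀ p : ℝ × ℝ, 0 < p.1 → F p = G p) (p : ℝ × ℝ)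
    (hp : 0 < p.1) : fderiv ℝ F p = fderiv ℝ G p := by
  apply Filter.EventuallyEq.fderiv_eq
  filter_upwards [aux_open.mem_nhds hp] with q hq using h q hq

theorem aux_const {F : ℝ × ℝ → ℝ} (hd : ∀ p : ℝ × ℝ, 0 < p.1 → DifferentiableAt ℝ F p)
    (h1 : ∀ p : ℝ × ℝ, 0 < p.1 → pd1 F p = 0) (h2 : ∀ p : ℝ × ℝ, 0 < p.1 → pd2 F p = 0)
    (p : ℝ × ℝ) (hp : 0 < p.1) : F p = F (1, 0) := by
  have hconv : Convex ℝ {p : ℝ × ℝ | 0 < p.1} :=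
    convex_halfSpace_gt (LinearMap.isLinear (LinearMap.fst ℝ ℝ ℝ)) 0
  refine aux_open.is_const_of_fderiv_eq_zero hconv.isPreconnected
    (fun q hq => (hd q hq).differentiableWithinAt) ?_ hp (by simp)
  intro q hq
  have e1 := h1 q hq
  have e2 := h2 q hq
  unfold pd1 at e1
  unfold pd2 at e2
  ext <;> simpa

theorem aux_smooth {F : ℝ × ℝ → ℝ} (h : ContDiffOn ℝ (⊤ : ℕ∞) F {p : ℝ × ℝ | 0 < p.1})
    (v : ℝ × ℝ) :
    ContDiffOn ℝ (⊤ : ℕ∞) (fun p => fderiv ℝ F p v) {p : ℝ × ℝ | 0 < p.1} :=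
  (h.fderiv_of_isOpen aux_open (by simp)).clm_apply contDiffOn_const

theorem aux_diff {F : ℝ × ℝ → ℝ} (h : ContDiffOn ℝ (⊤ : ℕ∞) F {p : ℝ × ℝ | 0 < p.1})
    (p : ℝ × ℝ) (hp : 0 < p.1) : DifferentiableAt ℝ F p :=
  (h.contDiffAt (aux_open.mem_nhds hp)).differentiableAt (by simp)

theorem aux_symm {F : ℝ × ℝ → ℝ} (h : ContDiffOn ℝ (⊤ : ℕ∞) F {p : ℝ × ℝ | 0 < p.1})
    (p : ℝ × ℝ) (hp : 0 < p.1) : pd2 (pd1 F) p = pd1 (pd2 F) p := by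
  have hc := h.contDiffAt (aux_open.mem_nhds hp)
  have hs := hc.isSymmSndFDerivAt (by
    rw [minSmoothness_of_isRCLikeNormedField]
    exact WithTop.coe_le_coe.2 (le_top : (2 : ℕ∞) ≤ ⊤))
  have hd : DifferentiableAt ℝ (fderiv ℝ F) p :=
    ((h.fderiv_of_isOpen (m := (⊤ : ℕ∞)) aux_open (by simp)).contDiffAt
      (aux_open.mem_nhds hp)).differentiableAt (by simp)
  have key : ∀ v w : ℝ × ℝ, fderiv ℝ (fun q => fderiv ℝ F q v) p w
      = fderiv ℝ (fderiv ℝ F) p w v := by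
    intro v w
    rw [fderiv_clm_apply hd (differentiableAt_const v)]
    simp
  unfold pd1 pd2
  rw [key, key]
  exact hs _ _

theorem aux_div (c : ℝ) (p : ℝ × ℝ) (hp : 0 < p.1) :
    HasFDerivAt (fun q : ℝ × ℝ => c / q.1) ((-c / p.1 ^ 2) • ContinuousLinearMap.fst ℝ ℝ ℝ) p := by
  have h : HasDerivAt (fun x : ℝ => c / x) (-c / p.1 ^ 2) p.1 := by
    have := (hasDerivAt_inv hp.ne').const_mul c
    have e : -c / p.1 ^ 2 = c * -(p.1 ^ 2)⁻¹ := by ring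
    rw [e]
    simpa only [div_eq_mul_inv] using this
  exact h.comp_hasFDerivAt p hasFDerivAt_fst

theorem aux_log (b : ℝ) (p : ℝ × ℝ) (hp : 0 < p.1) :
    HasFDerivAt (fun q : ℝ × ℝ => b * Real.log q.1)
      ((b / p.1) • ContinuousLinearMap.fst ℝ ℝ ℝ) p := by
  have h : HasDerivAt (fun x : ℝ => b * Real.log x) (b / p.1) p.1 :=
    (Real.hasDerivAt_log hp.ne').const_mul b
  exact h.comp_hasFDerivAt p hasFDerivAt_fst

/-- For the Type B connection with Γ₁₁¹ = −1/x¹, Γ₁₁² = C₁₁²/x¹, Γ₁₂² = C₁₂²/x¹,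
Γ₂₂² = C₂₂²/x¹ (C₂₂² ≠ 0) and Γ₁₂¹ = Γ₂₂¹ = 0 on {x¹ > 0}, the smooth functions with
vanishing affine Hessian (the quasi-Einstein equation with μ = 0) are exactly the span
of 1 and log x¹. -/
theorem stmt17 (C112 C122 C222 : ℝ) (hC : C222 ≠ 0) (f : ℝ × ℝ → ℝ) :
    (ContDiffOn ℝ (⊤ : ℕ∞) f {p : ℝ × ℝ | 0 < p.1} ∧
      ∀ p : ℝ × ℝ, 0 < p.1 →
        pd1 (pd1 f) p - (-1 / p.1) * pd1 f p - (C112 / p.1) * pd2 f p = 0 ∧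
        pd1 (pd2 f) p - (C122 / p.1) * pd2 f p = 0 ∧
        pd2 (pd2 f) p - (C222 / p.1) * pd2 f p = 0) ↔
    (∃ a b : ℝ, ∀ p : ℝ × ℝ, 0 < p.1 →
      f p = a * 1 + b * Real.log p.1) := by
  constructor
  · rintro ⟨hf, H⟩
    have s2 : ContDiffOn ℝ (⊤ : ℕ∞) (pd2 f) {p : ℝ × ℝ | 0 < p.1} := aux_smooth hf (0, 1)
    have s1 : ContDiffOn ℝ (⊤ : ℕ∞) (pd1 f) {p : ℝ × ℝ | 0 < p.1} := aux_smooth hf (1, 0)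
    have g0 : ∀ p : ℝ × ℝ, 0 < p.1 → pd2 f p = 0 := by
      intro p hp
      have hsy := aux_symm s2 p hp
      have hd := (aux_diff s2 p hp).hasFDerivAt
      have e1 : pd2 (pd1 (pd2 f)) p = (C122 / p.1) * pd2 (pd2 f) p := by
        have := aux_congr (F := pd1 (pd2 f)) (G := fun q => (C122 / q.1) * pd2 f q)
          (fun q hq => by linarith [(H q hq).2.1]) p hp
        change fderiv ℝ (pd1 (pd2 f)) p (0, 1) = _
        rw [this.trans ((aux_div C122 p hp).mul hd).fderiv]
        simp [pd2]
      have e2 : pd1 (pd2 (pd2 f)) p = (C222 / p.1) * pd1 (pd2 f) p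
          + pd2 f p * (-C222 / p.1 ^ 2) := by
        have := aux_congr (F := pd2 (pd2 f)) (G := fun q => (C222 / q.1) * pd2 f q)
          (fun q hq => by linarith [(H q hq).2.2]) p hp
        change fderiv ℝ (pd2 (pd2 f)) p (1, 0) = _
        rw [this.trans ((aux_div C222 p hp).mul hd).fderiv]
        simp [pd1]
      have h1 : pd1 (pd2 f) p = C122 / p.1 * pd2 f p := by linarith [(H p hp).2.1]
      have h2 : pd2 (pd2 f) p = C222 / p.1 * pd2 f p := by linarith [(H p hp).2.2]
      rw [e1, e2, h1, h2] at hsy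
      have h3 : pd2 f p * (-C222 / p.1 ^ 2) = 0 := by linear_combination -hsy
      rcases mul_eq_zero.1 h3 with h | h
      · exact h
      · exact absurd h (div_ne_zero (neg_ne_zero.2 hC) (pow_ne_zero _ hp.ne'))
    have hmul : ∀ p : ℝ × ℝ, 0 < p.1 → HasFDerivAt (fun q : ℝ × ℝ => q.1 * pd1 f q)
        (p.1 • fderiv ℝ (pd1 f) p + pd1 f p • ContinuousLinearMap.fst ℝ ℝ ℝ) p :=
      fun p hp => hasFDerivAt_fst.mul (aux_diff s1 p hp).hasFDerivAt
    have hb := aux_const (F := fun q : ℝ × ℝ => q.1 * pd1 f q)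
      (fun p hp => (hmul p hp).differentiableAt)
      (fun p hp => by
        have e := (H p hp).1
        rw [g0 p hp] at e
        change fderiv ℝ (_ : ℝ × ℝ → ℝ) p ((1 : ℝ), (0 : ℝ)) = 0
        rw [(hmul p hp).fderiv]
        change p.1 * pd1 (pd1 f) p + pd1 f p * 1 = 0
        have hp' := hp.ne'
        field_simp at e
        linarith)
      (fun p hp => by
        change fderiv ℝ (_ : ℝ × ℝ → ℝ) p ((0 : ℝ), (1 : ℝ)) = 0
        rw [(hmul p hp).fderiv]
        change p.1 * pd2 (pd1 f) p + pd1 f p * 0 = 0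
        have h1 := (H p hp).2.1
        rw [g0 p hp] at h1
        rw [aux_symm hf p hp]
        linear_combination p.1 * h1)
    obtain ⟨b, hb'⟩ : ∃ b, b = pd1 f (1, 0) := ⟨_, rfl⟩
    simp only [one_mul, ← hb'] at hb
    have hsub : ∀ p : ℝ × ℝ, 0 < p.1 → HasFDerivAt (fun q : ℝ × ℝ => f q - b * Real.log q.1)
        (fderiv ℝ f p - (b / p.1) • ContinuousLinearMap.fst ℝ ℝ ℝ) p :=
      fun p hp => (aux_diff hf p hp).hasFDerivAt.sub (aux_log b p hp)
    have ha := aux_const (F := fun q : ℝ × ℝ => f q - b * Real.log q.1)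
      (fun p hp => (hsub p hp).differentiableAt)
      (fun p hp => by
        change fderiv ℝ (_ : ℝ × ℝ → ℝ) p ((1 : ℝ), (0 : ℝ)) = 0
        rw [(hsub p hp).fderiv]
        change pd1 f p - b / p.1 * 1 = 0
        rw [← hb p hp]
        have hp' := hp.ne'
        field_simp
        ring)
      (fun p hp => by
        change fderiv ℝ (_ : ℝ × ℝ → ℝ) p ((0 : ℝ), (1 : ℝ)) = 0
        rw [(hsub p hp).fderiv]
        change pd2 f p - b / p.1 * 0 = 0
        rw [g0 p hp]
        ring)
    refine ⟨f (1, 0) - b * Real.log 1, b, fun p hp => ?_⟩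
    have := ha p hp
    simp only at this
    linarith
  · rintro ⟨a, b, h⟩
    have hfd : ∀ p : ℝ × ℝ, 0 < p.1 →
        fderiv ℝ f p = (b / p.1) • ContinuousLinearMap.fst ℝ ℝ ℝ := by
      intro p hp
      rw [aux_congr h p hp]
      exact ((aux_log b p hp).const_add (a * 1)).fderiv
    have p1 : ∀ p : ℝ × ℝ, 0 < p.1 → pd1 f p = b / p.1 := by
      intro p hp
      simp [pd1, hfd p hp]
    have p2 : ∀ p : ℝ × ℝ, 0 < p.1 → pd2 f p = 0 := by
      intro p hp
      simp [pd2, hfd p hp]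
    refine ⟨?_, fun p hp => ?_⟩
    · refine ContDiffOn.congr (f := fun p : ℝ × ℝ => a * 1 + b * Real.log p.1) ?_ h
      exact contDiffOn_const.add (contDiffOn_const.mul
        (contDiffOn_fst.log (fun p hp => ne_of_gt hp)))
    · have q11 : pd1 (pd1 f) p = -b / p.1 ^ 2 := by
        change fderiv ℝ (pd1 f) p (1, 0) = _
        rw [aux_congr p1 p hp, (aux_div b p hp).fderiv]
        simp
      have q2 : fderiv ℝ (pd2 f) p = 0 := by
        rw [aux_congr (G := fun _ => 0) p2 p hp]
        simp
      have q12 : pd1 (pd2 f) p = 0 := by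
        change fderiv ℝ (pd2 f) p (1, 0) = _
        simp [q2]
      have q22 : pd2 (pd2 f) p = 0 := by
        change fderiv ℝ (pd2 f) p (0, 1) = _
        simp [q2]
      rw [q11, q12, q22, p1 p hp, p2 p hp]
      have hp' := hp.ne'
      refine ⟨?_, by ring, by ring⟩
      field_simp
      ring
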